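/- arXiv:math/0403485 — 7 statements merged into one kernel-verified Lean document; each statement's English description precedes it below -/
import Mathlib

section
/- Let a be a real number, let b with a < b ≤ ∞, and let f be a twice continuously differentiable real-valued function on [a,b). Assume that f(τ) → −∞ as τ → b, and that there exist constants γ̃ > 0 and m > 0 such that |f′(τ)|² e^{2γ̃ f(τ)} → m as τ → b. Then b is finite. -/
open Filter Topology

/-- If `g` tends to a finite limit at infinity, then its derivative takes values of arbitrarily
small square arbitrarily far out. -/
theorem not_eventually_le_sq_deriv_of_tendsto {g : ℝ → ℝ} {c l : ℝ} (hc : 0 < c)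
    (hg : Tendsto g atTop (𝓝 l)) : ¬ ∀ᶠ t in atTop, c ≤ deriv g t ^ 2 := by
  intro h
  have hdiff : Tendsto (fun t => (g (t + 1) - g t) ^ 2) atTop (𝓝 0) := by
    simpa using ((hg.comp (tendsto_atTop_add_const_right _ 1 tendsto_id)).sub hg).pow 2
  obtain ⟨T, hT⟩ := eventually_atTop.1 h
  have hd (t : ℝ) (ht : T ≤ t) : DifferentiableAt ℝ g t := by
    refine differentiableAt_of_deriv_ne_zero fun h0 => ?_
    have := hT t ht
    rw [h0] at this
    norm_num at this
    linarith
  obtain ⟨t, hlt, ht⟩ := ((hdiff.eventually (gt_mem_nhds hc)).and (eventually_ge_atTop T)).exists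
  obtain ⟨s, hs, hs'⟩ := exists_deriv_eq_slope g (lt_add_one t)
    (fun x hx => (hd x (ht.trans hx.1)).continuousAt.continuousWithinAt)
    (fun x hx => (hd x (ht.trans hx.1.le)).differentiableWithinAt)
  have := hT s (ht.trans hs.1.le)
  rw [hs', add_sub_cancel_left, div_one] at this
  linarith

/-- If `f` is `C²` on `[a,b)` with `f → -∞` and `|f'|² e^{2γf} → m > 0` as `τ → b`,
then `b` is finite. Here `b : EReal` with `a < b ≤ ∞`, and the limit `τ → b` from
the left is expressed via the pullback of the left-neighbourhood filter of `b`. -/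
theorem big_crunch_time_finite (a : ℝ) (b : EReal) (hab : (a : EReal) < b)
    (f : ℝ → ℝ) (γ m : ℝ) (hγ : 0 < γ) (hm : 0 < m)
    (hf : ContDiffOn ℝ 2 f {τ : ℝ | a ≤ τ ∧ (τ : EReal) < b})
    (hfb : Tendsto f (Filter.comap (fun τ : ℝ => (τ : EReal)) (𝓝[<] b)) atBot)
    (hlim : Tendsto (fun τ : ℝ => (deriv f τ) ^ 2 * Real.exp (2 * γ * f τ))
      (Filter.comap (fun τ : ℝ => (τ : EReal)) (𝓝[<] b)) (𝓝 m)) :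
    b ≠ ⊤ := by
  rintro rfl
  have hle : (atTop : Filter ℝ) ≤ comap (fun τ : ℝ => (τ : EReal)) (𝓝[<] ⊤) := by
    rw [← tendsto_iff_comap]
    exact tendsto_nhdsWithin_iff.2 ⟨EReal.tendsto_coe_nhds_top_iff.2 tendsto_id,
      Eventually.of_forall EReal.coe_lt_top⟩
  replace hfb := hfb.mono_left hle
  replace hlim := hlim.mono_left hle
  have hg : Tendsto (fun τ => Real.exp (γ * f τ)) atTop (𝓝 0) :=
    Real.tendsto_exp_atBot.comp (hfb.const_mul_atBot hγ)
  refine not_eventually_le_sq_deriv_of_tendsto (c := γ ^ 2 * (m / 2)) (by positivity) hg ?_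
  filter_upwards [hlim.eventually (lt_mem_nhds (half_lt_self hm))] with τ hτ
  have hd : DifferentiableAt ℝ f τ := by
    refine differentiableAt_of_deriv_ne_zero fun h0 => ?_
    rw [h0] at hτ
    norm_num at hτ
    linarith
  rw [((hd.hasDerivAt.const_mul γ).exp).deriv]
  calc γ ^ 2 * (m / 2) ≤ γ ^ 2 * (deriv f τ ^ 2 * Real.exp (2 * γ * f τ)) := by gcongr
    _ = (Real.exp (γ * f τ) * (γ * deriv f τ)) ^ 2 := by
      rw [mul_assoc 2, two_mul, Real.exp_add]
      ring
end

section
/- Let f be a twice continuously differentiable real-valued function on [a,0) with a < 0. Assume that f(τ) → −∞ as τ → 0⁻, that f′ < 0 on [a,0), and that there exist constants γ̃ > 0 and m > 0 such that |f′(τ)|² e^{2γ̃ f(τ)} → m as τ → 0⁻. Then e^{γ̃ f(τ)}/τ → −γ̃ √m as τ → 0⁻. -/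
open Filter Topology

/-- If `f` is `C²` on `[a,0)` with `f → -∞`, `f' < 0`, and `|f'|² e^{2γf} → m > 0`
as `τ → 0⁻`, then `e^{γ f(τ)}/τ → -γ √m` as `τ → 0⁻`. -/
theorem exp_gamma_f_div_tau_tendsto (a : ℝ) (ha : a < 0)
    (f : ℝ → ℝ) (γ m : ℝ) (hγ : 0 < γ) (hm : 0 < m)
    (hf : ContDiffOn ℝ 2 f (Set.Ico a 0))
    (hf' : ∀ τ ∈ Set.Ico a (0 : ℝ), deriv f τ < 0)
    (hfb : Tendsto f (𝓝[<] (0 : ℝ)) atBot)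
    (hlim : Tendsto (fun τ : ℝ => (deriv f τ) ^ 2 * Real.exp (2 * γ * f τ))
      (𝓝[<] (0 : ℝ)) (𝓝 m)) :
    Tendsto (fun τ : ℝ => Real.exp (γ * f τ) / τ) (𝓝[<] (0 : ℝ))
      (𝓝 (-γ * Real.sqrt m)) := by
  have hdiff : ∀ τ ∈ Set.Ioo a 0, HasDerivAt f (deriv f τ) τ := fun τ hτ =>
    (differentiableAt_of_deriv_ne_zero (hf' τ (Set.Ioo_subset_Ico_self hτ)).ne).hasDerivAt
  refine HasDerivAt.lhopital_zero_left_on_Ioo (g' := fun _ => 1) ha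
    (fun τ hτ => ((hdiff τ hτ).const_mul γ).exp) (fun τ _ => hasDerivAt_id' τ)
    (fun _ _ => one_ne_zero) (Real.tendsto_exp_atBot.comp (hfb.const_mul_atBot hγ))
    (tendsto_id.mono_left nhdsWithin_le_nhds) ?_
  refine ((Real.continuous_sqrt.tendsto m).comp hlim |>.const_mul (-γ)).congr' ?_
  filter_upwards [Ioo_mem_nhdsLT ha] with τ hτ
  have hneg := hf' τ (Set.Ioo_subset_Ico_self hτ)
  have hsq : deriv f τ ^ 2 * Real.exp (2 * γ * f τ) =
      (-deriv f τ * Real.exp (γ * f τ)) ^ 2 := by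
    rw [mul_pow, neg_sq, ← Real.exp_nat_mul]
    push_cast
    ring_nf
  simp only [Function.comp_apply]
  rw [hsq, Real.sqrt_sq (mul_nonneg (neg_nonneg.2 hneg.le) (Real.exp_pos _).le)]
  ring
end

section
/- Let f be a twice continuously differentiable real-valued function on [a,0) with a < 0. Assume that f(τ) → −∞ as τ → 0⁻, that f′ < 0 on [a,0), that there exist constants γ̃ > 0 and m > 0 such that |f′(τ)|² e^{2γ̃ f(τ)} → m as τ → 0⁻, and that the limit c₀ := lim_{τ→0⁻} ( f″(τ) + γ̃ |f′(τ)|² ) exists in ℝ. Then ( f′(τ) e^{γ̃ f(τ)} + √m ) / τ² → − c₀ γ̃ √m / 2 as τ → 0⁻. -/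
open Filter Topology

/-- If `f` is `C²` on `[a,0)` with `f → -∞`, `f' < 0`, `|f'|² e^{2γf} → m > 0`,
and `f'' + γ |f'|² → c₀` as `τ → 0⁻`, then
`(f' e^{γ f} + √m)/τ² → -c₀ γ √m / 2` as `τ → 0⁻`. -/
theorem asymptotic_f_prime_exp (a : ℝ) (ha : a < 0)
    (f : ℝ → ℝ) (γ m c₀ : ℝ) (hγ : 0 < γ) (hm : 0 < m)
    (hf : ContDiffOn ℝ 2 f (Set.Ico a 0))
    (hf' : ∀ τ ∈ Set.Ico a (0 : ℝ), deriv f τ < 0)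
    (hfb : Tendsto f (𝓝[<] (0 : ℝ)) atBot)
    (hlim : Tendsto (fun τ : ℝ => (deriv f τ) ^ 2 * Real.exp (2 * γ * f τ))
      (𝓝[<] (0 : ℝ)) (𝓝 m))
    (hlim2 : Tendsto (fun τ : ℝ => deriv (deriv f) τ + γ * (deriv f τ) ^ 2)
      (𝓝[<] (0 : ℝ)) (𝓝 c₀)) :
    Tendsto (fun τ : ℝ => (deriv f τ * Real.exp (γ * f τ) + Real.sqrt m) / τ ^ 2)
      (𝓝[<] (0 : ℝ)) (𝓝 (-(c₀ * γ * Real.sqrt m) / 2)) := by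
  have hIoo : ∀ᶠ τ in 𝓝[<] (0 : ℝ), τ ∈ Set.Ioo a 0 := Ioo_mem_nhdsLT ha
  have hcd : ∀ᶠ τ in 𝓝[<] (0 : ℝ), ContDiffAt ℝ 2 f τ := by
    filter_upwards [hIoo] with τ hτ
    exact hf.contDiffAt (Ico_mem_nhds hτ.1 hτ.2)
  have hexp : ∀ᶠ τ in 𝓝[<] (0 : ℝ), HasDerivAt (fun t => Real.exp (γ * f t))
      (γ * (deriv f τ * Real.exp (γ * f τ))) τ := by
    filter_upwards [hcd] with τ hτ
    have h := ((hτ.differentiableAt (by norm_num)).hasDerivAt.const_mul γ).exp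
    exact h.congr_deriv (by ring)
  have hprod : ∀ᶠ τ in 𝓝[<] (0 : ℝ),
      HasDerivAt (fun t => deriv f t * Real.exp (γ * f t) + Real.sqrt m)
        ((deriv (deriv f) τ + γ * (deriv f τ) ^ 2) * Real.exp (γ * f τ)) τ := by
    filter_upwards [hcd, hexp] with τ hτ he
    have hd : DifferentiableAt ℝ (deriv f) τ :=
      (hτ.derivWithin (m := 1) (by norm_num)).differentiableAt (by norm_num)
    exact ((hd.hasDerivAt.mul he).add_const _).congr_deriv (by ring)
  have hexp_zero : Tendsto (fun τ => Real.exp (γ * f τ)) (𝓝[<] (0 : ℝ)) (𝓝 0) :=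
    Real.tendsto_exp_atBot.comp (hfb.const_mul_atBot hγ)
  have hprod_lim : Tendsto (fun τ => deriv f τ * Real.exp (γ * f τ)) (𝓝[<] (0 : ℝ))
      (𝓝 (-Real.sqrt m)) := by
    refine hlim.sqrt.neg.congr' ?_
    filter_upwards [hIoo] with τ hτ
    have hneg : deriv f τ * Real.exp (γ * f τ) ≤ 0 :=
      mul_nonpos_of_nonpos_of_nonneg (hf' τ ⟨hτ.1.le, hτ.2⟩).le (Real.exp_pos _).le
    have hsq : (deriv f τ) ^ 2 * Real.exp (2 * γ * f τ)
        = (deriv f τ * Real.exp (γ * f τ)) ^ 2 := by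
      rw [mul_pow, ← Real.exp_nat_mul]
      push_cast
      ring_nf
    rw [hsq, Real.sqrt_sq_eq_abs, abs_of_nonpos hneg, neg_neg]
  have hid_zero : Tendsto (fun τ : ℝ => τ) (𝓝[<] (0 : ℝ)) (𝓝 0) :=
    tendsto_id.mono_left nhdsWithin_le_nhds
  have hexp_div : Tendsto (fun τ => Real.exp (γ * f τ) / τ) (𝓝[<] (0 : ℝ))
      (𝓝 (γ * -Real.sqrt m)) := by
    refine HasDerivAt.lhopital_zero_nhdsLT hexp
      (Eventually.of_forall fun τ => hasDerivAt_id' τ)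
      (Eventually.of_forall fun _ => one_ne_zero) hexp_zero hid_zero ?_
    simpa using hprod_lim.const_mul γ
  refine HasDerivAt.lhopital_zero_nhdsLT hprod
    (g' := fun τ => 2 * τ) (Eventually.of_forall fun τ => ?_) ?_ ?_ ?_ ?_
  · simpa using hasDerivAt_pow 2 τ
  · filter_upwards [hIoo] with τ hτ
    exact mul_ne_zero two_ne_zero hτ.2.ne
  · simpa using hprod_lim.add_const (Real.sqrt m)
  · simpa using hid_zero.pow 2
  · convert (hlim2.mul hexp_div).div_const 2 using 2 with τ
    · rw [← mul_div_assoc, div_div, mul_comm τ 2]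
    · ring
end

section
/- Let f be a twice continuously differentiable real-valued function on [a,0) with a < 0. Assume that f(τ) → −∞ as τ → 0⁻, that f′ < 0 on [a,0), that there exist constants γ̃ > 0 and m > 0 such that |f′(τ)|² e^{2γ̃ f(τ)} → m as τ → 0⁻, and that the limit lim_{τ→0⁻} ( f″(τ) + γ̃ |f′(τ)|² ) exists in ℝ. Then there exists a real constant c such that ( γ̃ f′(τ) τ − 1 ) / τ² → c as τ → 0⁻. -/
open Filter Topology

/-- If `g → 0`, `g' → k ≠ 0` and `g'' = q g` with `q → l` at `0⁻`, then
`(g' τ / g - 1) / τ² → l / 3`. -/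
theorem tendsto_logDeriv_mul_sub_one_div_sq {g g' q : ℝ → ℝ} {k l : ℝ} (hk : k ≠ 0)
    (hg : ∀ᶠ τ in 𝓝[<] (0 : ℝ), HasDerivAt g (g' τ) τ)
    (hg' : ∀ᶠ τ in 𝓝[<] (0 : ℝ), HasDerivAt g' (q τ * g τ) τ)
    (hpos : ∀ᶠ τ in 𝓝[<] (0 : ℝ), g τ ≠ 0)
    (hg0 : Tendsto g (𝓝[<] (0 : ℝ)) (𝓝 0))
    (hgk : Tendsto g' (𝓝[<] (0 : ℝ)) (𝓝 k))
    (hq : Tendsto q (𝓝[<] (0 : ℝ)) (𝓝 l)) :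
    Tendsto (fun τ : ℝ => (g' τ / g τ * τ - 1) / τ ^ 2) (𝓝[<] (0 : ℝ)) (𝓝 (l / 3)) := by
  have hid : Tendsto (fun τ : ℝ => τ) (𝓝[<] (0 : ℝ)) (𝓝 0) :=
    tendsto_id.mono_left nhdsWithin_le_nhds
  have hne : ∀ᶠ τ in 𝓝[<] (0 : ℝ), τ ≠ 0 := by
    filter_upwards [self_mem_nhdsWithin] with τ hτ using ne_of_lt hτ
  have hratio : Tendsto (fun τ : ℝ => g τ / τ) (𝓝[<] (0 : ℝ)) (𝓝 k) :=
    HasDerivAt.lhopital_zero_nhdsLT hg (Eventually.of_forall hasDerivAt_id')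
      (Eventually.of_forall fun _ => one_ne_zero) hg0 hid (by simpa using hgk)
  have hcubic : Tendsto (fun τ : ℝ => (g' τ * τ - g τ) / τ ^ 3) (𝓝[<] (0 : ℝ))
      (𝓝 (l * k / 3)) := by
    refine HasDerivAt.lhopital_zero_nhdsLT (f' := fun τ => q τ * g τ * τ)
      (g' := fun τ => 3 * τ ^ 2) ?_ ?_ ?_ ?_ ?_ ?_
    · filter_upwards [hg, hg'] with τ h h'
      exact ((h'.mul (hasDerivAt_id' τ)).sub h).congr_deriv (by ring)
    · exact Eventually.of_forall fun τ => by simpa using hasDerivAt_pow 3 τ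
    · filter_upwards [hne] with τ hτ
      positivity
    · simpa using (hgk.mul hid).sub hg0
    · simpa using hid.pow 3
    · refine ((hq.mul hratio).div_const 3).congr' ?_
      filter_upwards [hne] with τ hτ
      field_simp
  have hquot := hcubic.div hratio hk
  rw [show l * k / 3 / k = l / 3 by field_simp] at hquot
  refine hquot.congr' ?_
  filter_upwards [hne, hpos] with τ hτ hgτ
  simp only [Pi.div_apply]
  field_simp

/-- If `f` is `C²` on `[a,0)` with `f → -∞`, `f' < 0`, `|f'|² e^{2γf} → m > 0`,
and `f'' + γ |f'|²` converges as `τ → 0⁻`, then `(γ f'(τ) τ - 1)/τ²` converges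
as `τ → 0⁻`. -/
theorem asymptotic_gamma_f_prime_tau (a : ℝ) (ha : a < 0)
    (f : ℝ → ℝ) (γ m : ℝ) (hγ : 0 < γ) (hm : 0 < m)
    (hf : ContDiffOn ℝ 2 f (Set.Ico a 0))
    (hf' : ∀ τ ∈ Set.Ico a (0 : ℝ), deriv f τ < 0)
    (hfb : Tendsto f (𝓝[<] (0 : ℝ)) atBot)
    (hlim : Tendsto (fun τ : ℝ => (deriv f τ) ^ 2 * Real.exp (2 * γ * f τ))
      (𝓝[<] (0 : ℝ)) (𝓝 m))
    (hlim2 : ∃ c₀ : ℝ, Tendsto (fun τ : ℝ => deriv (deriv f) τ + γ * (deriv f τ) ^ 2)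
      (𝓝[<] (0 : ℝ)) (𝓝 c₀)) :
    ∃ c : ℝ, Tendsto (fun τ : ℝ => (γ * deriv f τ * τ - 1) / τ ^ 2)
      (𝓝[<] (0 : ℝ)) (𝓝 c) := by
  obtain ⟨c₀, hc₀⟩ := hlim2
  have hIoo : ∀ᶠ τ in 𝓝[<] (0 : ℝ), τ ∈ Set.Ioo a 0 := Ioo_mem_nhdsLT ha
  have hC2 : ContDiffOn ℝ 2 f (Set.Ioo a 0) := hf.mono Set.Ioo_subset_Ico_self
  have hC1 : ContDiffOn ℝ 1 (deriv f) (Set.Ioo a 0) :=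
    hC2.deriv_of_isOpen isOpen_Ioo (by norm_num)
  have hd : ∀ τ ∈ Set.Ioo a 0, HasDerivAt f (deriv f τ) τ := fun τ hτ =>
    ((hC2.differentiableOn (by norm_num)).differentiableAt (isOpen_Ioo.mem_nhds hτ)).hasDerivAt
  have hdd : ∀ τ ∈ Set.Ioo a 0, HasDerivAt (deriv f) (deriv (deriv f) τ) τ := fun τ hτ =>
    ((hC1.differentiableOn (by norm_num)).differentiableAt (isOpen_Ioo.mem_nhds hτ)).hasDerivAt
  have hexp : ∀ τ ∈ Set.Ioo a 0, HasDerivAt (fun τ => Real.exp (γ * f τ))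
      (γ * deriv f τ * Real.exp (γ * f τ)) τ := fun τ hτ =>
    ((hd τ hτ).const_mul γ).exp.congr_deriv (by ring)
  have hexp_lim : Tendsto (fun τ => γ * deriv f τ * Real.exp (γ * f τ)) (𝓝[<] (0 : ℝ))
      (𝓝 (-(γ * √m))) := by
    refine (hlim.sqrt.const_mul γ).neg.congr' ?_
    filter_upwards [hIoo] with τ hτ
    have hsq : deriv f τ ^ 2 * Real.exp (2 * γ * f τ)
        = (-deriv f τ * Real.exp (γ * f τ)) ^ 2 := by
      rw [mul_pow, ← Real.exp_nat_mul, neg_sq]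
      push_cast
      ring_nf
    have hneg := hf' τ (Set.Ioo_subset_Ico_self hτ)
    rw [hsq, Real.sqrt_sq (mul_nonneg (by linarith) (Real.exp_pos _).le)]
    ring
  refine ⟨γ * c₀ / 3, (tendsto_logDeriv_mul_sub_one_div_sq
    (g := fun τ => Real.exp (γ * f τ))
    (q := fun τ => γ * (deriv (deriv f) τ + γ * deriv f τ ^ 2))
    (neg_ne_zero.2 (mul_pos hγ (Real.sqrt_pos.2 hm)).ne') (hIoo.mono hexp) ?_
    (Eventually.of_forall fun τ => (Real.exp_pos _).ne')
    (Real.tendsto_exp_atBot.comp (hfb.const_mul_atBot hγ)) hexp_lim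
    (hc₀.const_mul γ)).congr fun τ => ?_⟩
  · filter_upwards [hIoo] with τ hτ
    exact (((hdd τ hτ).const_mul γ).mul (hexp τ hτ)).congr_deriv (by ring)
  · rw [mul_div_cancel_right₀ _ (Real.exp_pos _).ne']
end

section
/- Let f be a twice continuously differentiable real-valued function on [a,0) with a < 0. Assume that f(τ) → −∞ as τ → 0⁻, that f′ < 0 on [a,0), that there exist constants γ̃ > 0 and m > 0 such that |f′(τ)|² e^{2γ̃ f(τ)} → m as τ → 0⁻, and that the function f″ + γ̃ |f′|² is bounded on [a,0). Then f″(τ) → −∞ as τ → 0⁻; in particular, for every constant K > 0 there exists τ₀ ∈ (a,0) such that −f″(τ) ≥ K |f′(τ)| for all τ ∈ [τ₀, 0). -/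
open Filter Topology

/-- If `f` is `C²` on `[a,0)` with `f → -∞`, `f' < 0`, `|f'|² e^{2γf} → m > 0`,
and `f'' + γ |f'|²` is bounded on `[a,0)`, then `f'' → -∞` as `τ → 0⁻`; in
particular `-f''` eventually dominates any multiple of `|f'|`. -/
theorem second_deriv_tendsto_atBot (a : ℝ) (ha : a < 0)
    (f : ℝ → ℝ) (γ m : ℝ) (hγ : 0 < γ) (hm : 0 < m)
    (hf : ContDiffOn ℝ 2 f (Set.Ico a 0))
    (hf' : ∀ τ ∈ Set.Ico a (0 : ℝ), deriv f τ < 0)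
    (hfb : Tendsto f (𝓝[<] (0 : ℝ)) atBot)
    (hlim : Tendsto (fun τ : ℝ => (deriv f τ) ^ 2 * Real.exp (2 * γ * f τ))
      (𝓝[<] (0 : ℝ)) (𝓝 m))
    (hbd : ∃ C : ℝ, ∀ τ ∈ Set.Ico a (0 : ℝ),
      |deriv (deriv f) τ + γ * (deriv f τ) ^ 2| ≤ C) :
    Tendsto (deriv (deriv f)) (𝓝[<] (0 : ℝ)) atBot ∧
    ∀ K : ℝ, 0 < K → ∃ τ₀ ∈ Set.Ioo a (0 : ℝ),
      ∀ τ ∈ Set.Ico τ₀ (0 : ℝ), K * |deriv f τ| ≤ -deriv (deriv f) τ := by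
  obtain ⟨C, hC⟩ := hbd
  have hexp : Tendsto (fun τ : ℝ => Real.exp (-(2 * γ * f τ))) (𝓝[<] (0 : ℝ)) atTop :=
    Real.tendsto_exp_atTop.comp
      (tendsto_neg_atBot_atTop.comp (hfb.const_mul_atBot (by positivity)))
  have hsq : Tendsto (fun τ : ℝ => (deriv f τ) ^ 2) (𝓝[<] (0 : ℝ)) atTop := by
    refine (hlim.pos_mul_atTop hm hexp).congr fun τ => ?_
    rw [mul_assoc, ← Real.exp_add, add_neg_cancel, Real.exp_zero, mul_one]
  have hmem : ∀ᶠ τ in 𝓝[<] (0 : ℝ), τ ∈ Set.Ico a 0 := Ico_mem_nhdsLT ha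
  constructor
  · have hupper : Tendsto (fun τ : ℝ => C - γ * (deriv f τ) ^ 2) (𝓝[<] (0 : ℝ)) atBot :=
      tendsto_atBot_add_const_left _ C
        (tendsto_neg_atTop_atBot.comp (hsq.const_mul_atTop hγ))
    refine tendsto_atBot_mono' _ ?_ hupper
    filter_upwards [hmem] with τ hτ
    linarith [(abs_le.mp (hC τ hτ)).2]
  · intro K _
    have hev : ∀ᶠ τ in 𝓝[<] (0 : ℝ), K * |deriv f τ| ≤ -deriv (deriv f) τ := by
      filter_upwards [hmem,
        (hsq.const_mul_atTop (half_pos hγ)).eventually_ge_atTop (C + K ^ 2 / (2 * γ))]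
        with τ hτ hlarge
      have hyoung : K * |deriv f τ| ≤ γ / 2 * (deriv f τ) ^ 2 + K ^ 2 / (2 * γ) := by
        have hdiff : γ / 2 * |deriv f τ| ^ 2 + K ^ 2 / (2 * γ) - K * |deriv f τ|
            = (γ * |deriv f τ| - K) ^ 2 / (2 * γ) := by
          field_simp
          ring
        have hnonneg : 0 ≤ (γ * |deriv f τ| - K) ^ 2 / (2 * γ) := by positivity
        rw [sq_abs] at hdiff
        linarith
      linarith [(abs_le.mp (hC τ hτ)).2]
    obtain ⟨l, hl, hsub⟩ := (mem_nhdsLT_iff_exists_mem_Ico_Ioo_subset ha).mp hev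
    have hl0 : l < 0 := hl.2
    exact ⟨l / 2, ⟨by linarith [hl.1], by linarith⟩,
      fun τ hτ => hsub ⟨by linarith [hτ.1], hτ.2⟩⟩
end

section
/- Let f be a twice continuously differentiable real-valued function on [a,0) with a < 0. Assume that f(τ) → −∞ as τ → 0⁻, that f′ < 0 on [a,0), that there exist constants γ̃ > 0 and m > 0 such that |f′(τ)|² e^{2γ̃ f(τ)} → m as τ → 0⁻, and that the function f″ + γ̃ |f′|² is bounded on [a,0). Then there exists a constant c > 0 such that |f″(τ)| ≤ c |f′(τ)|² for all τ ∈ [a,0). -/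
open Filter Topology

/-- A `C¹` function on `[a, b)` has a continuous two-sided derivative on `[a, b)`, provided the
two-sided derivative does not vanish there (so that it exists at the left endpoint). -/
theorem ContDiffOn.continuousOn_deriv_Ico {f : ℝ → ℝ} {a b : ℝ}
    (hf : ContDiffOn ℝ 1 f (Set.Ico a b)) (hne : ∀ x ∈ Set.Ico a b, deriv f x ≠ 0) :
    ContinuousOn (deriv f) (Set.Ico a b) := by
  refine (hf.continuousOn_derivWithin (uniqueDiffOn_Ico a b) le_rfl).congr fun x hx => ?_
  exact ((differentiableAt_of_deriv_ne_zero (hne x hx)).derivWithin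
    (uniqueDiffOn_Ico a b x hx)).symm

/-- A continuous positive function on `[a, b)` that is bounded below by a positive constant
near `b` is bounded below by a positive constant on `[a, b)`. -/
theorem ContinuousOn.exists_pos_forall_le_Ico {g : ℝ → ℝ} {a b ε : ℝ}
    (hg : ContinuousOn g (Set.Ico a b)) (hpos : ∀ x ∈ Set.Ico a b, 0 < g x) (hε : 0 < ε)
    (hev : ∀ᶠ x in 𝓝[<] b, ε ≤ g x) :
    ∃ δ, 0 < δ ∧ ∀ x ∈ Set.Ico a b, δ ≤ g x := by
  obtain ⟨l, hl, hlb⟩ := (mem_nhdsLT_iff_exists_Ioo_subset).1 hev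
  have hsub : Set.Icc a l ⊆ Set.Ico a b := fun x hx => ⟨hx.1, hx.2.trans_lt hl⟩
  obtain ⟨δ, hδ, hδg⟩ := isCompact_Icc.exists_forall_le' (hg.mono hsub)
    (a := 0) fun x hx => hpos x (hsub hx)
  refine ⟨min δ ε, lt_min hδ hε, fun x hx => ?_⟩
  rcases le_or_gt x l with h | h
  · exact (min_le_left _ _).trans (hδg x ⟨hx.1, h⟩)
  · exact (min_le_right _ _).trans (hlb ⟨h, hx.2⟩)

/-- If `f` is `C²` on `[a,0)` with `f → -∞`, `f' < 0`, `|f'|² e^{2γf} → m > 0`,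
and `f'' + γ |f'|²` is bounded on `[a,0)`, then `|f''| ≤ c |f'|²` on `[a,0)`
for some constant `c > 0`. -/
theorem second_deriv_bound (a : ℝ) (ha : a < 0)
    (f : ℝ → ℝ) (γ m : ℝ) (hγ : 0 < γ) (hm : 0 < m)
    (hf : ContDiffOn ℝ 2 f (Set.Ico a 0))
    (hf' : ∀ τ ∈ Set.Ico a (0 : ℝ), deriv f τ < 0)
    (hfb : Tendsto f (𝓝[<] (0 : ℝ)) atBot)
    (hlim : Tendsto (fun τ : ℝ => (deriv f τ) ^ 2 * Real.exp (2 * γ * f τ))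
      (𝓝[<] (0 : ℝ)) (𝓝 m))
    (hbd : ∃ C : ℝ, ∀ τ ∈ Set.Ico a (0 : ℝ),
      |deriv (deriv f) τ + γ * (deriv f τ) ^ 2| ≤ C) :
    ∃ c : ℝ, 0 < c ∧ ∀ τ ∈ Set.Ico a (0 : ℝ),
      |deriv (deriv f) τ| ≤ c * (deriv f τ) ^ 2 := by
  obtain ⟨C, hC⟩ := hbd
  have hC0 : 0 ≤ C := (abs_nonneg _).trans (hC a ⟨le_rfl, ha⟩)
  have hcont : ContinuousOn (deriv f) (Set.Ico a 0) :=
    (hf.of_le one_le_two).continuousOn_deriv_Ico fun x hx => (hf' x hx).ne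
  have hev : ∀ᶠ τ in 𝓝[<] (0 : ℝ), m / 2 ≤ (deriv f τ) ^ 2 := by
    filter_upwards [hlim.eventually_const_le (half_lt_self hm), hfb.eventually_le_atBot 0]
      with τ hτ hfτ
    refine hτ.trans (mul_le_of_le_one_right (sq_nonneg _) (Real.exp_le_one_iff.2 ?_))
    exact mul_nonpos_of_nonneg_of_nonpos (by positivity) hfτ
  obtain ⟨δ, hδ, hle⟩ := (hcont.pow 2).exists_pos_forall_le_Ico
    (fun x hx => sq_pos_of_neg (hf' x hx)) (half_pos hm) hev
  refine ⟨C / δ + γ, by positivity, fun τ hτ => ?_⟩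
  have hCδ : C ≤ C / δ * (deriv f τ) ^ 2 := by
    rw [div_mul_eq_mul_div, le_div_iff₀ hδ]
    exact mul_le_mul_of_nonneg_left (hle τ hτ) hC0
  have hγf : 0 ≤ γ * (deriv f τ) ^ 2 := by positivity
  have hb := abs_le.1 (hC τ hτ)
  rw [add_mul, abs_le]
  constructor <;> linarith
end

section
/- Let f be a three times continuously differentiable real-valued function on [a,0) with a < 0. Assume that f(τ) → −∞ as τ → 0⁻, that f′ < 0 on [a,0), that there exist constants γ̃ > 0 and m > 0 such that |f′(τ)|² e^{2γ̃ f(τ)} → m as τ → 0⁻, that the function f″ + γ̃ |f′|² is bounded on [a,0), and that there exists a constant c₁ with |(f″ + γ̃ |f′|²)′(τ)| ≤ c₁ |f′(τ)| for all τ ∈ [a,0). Then there exists a constant c > 0 such that | 2 (f″(τ))² − f′(τ) f‴(τ) | ≤ c |f′(τ)|² for all τ ∈ [a,0). -/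
open Filter Topology

/-- A function that is `C¹` on `[a,0)`, has non-vanishing two-sided derivative there, and
satisfies `f → -∞`, `|f'|² e^{2γf} → m > 0` at `0⁻` has `|f'|²` bounded away from zero. -/
theorem exists_pos_le_sq_deriv (a : ℝ) (ha : a < 0) (f : ℝ → ℝ) (γ m : ℝ) (hγ : 0 < γ)
    (hm : 0 < m) (hf : ContDiffOn ℝ 1 f (Set.Ico a 0))
    (hf' : ∀ τ ∈ Set.Ico a (0 : ℝ), deriv f τ ≠ 0)
    (hfb : Tendsto f (𝓝[<] (0 : ℝ)) atBot)
    (hlim : Tendsto (fun τ : ℝ => (deriv f τ) ^ 2 * Real.exp (2 * γ * f τ))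
      (𝓝[<] (0 : ℝ)) (𝓝 m)) :
    ∃ k : ℝ, 0 < k ∧ ∀ τ ∈ Set.Ico a (0 : ℝ), k ≤ (deriv f τ) ^ 2 := by
  have hcont : ContinuousOn (deriv f) (Set.Ico a 0) :=
    (hf.continuousOn_derivWithin (uniqueDiffOn_Ico a 0) le_rfl).congr fun τ hτ =>
      ((differentiableAt_of_deriv_ne_zero (hf' τ hτ)).derivWithin
        (uniqueDiffOn_Ico a 0 τ hτ)).symm
  have hnear : ∀ᶠ τ in 𝓝[<] (0 : ℝ), m / 2 ≤ (deriv f τ) ^ 2 := by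
    filter_upwards [hlim.eventually_const_lt (half_lt_self hm), hfb.eventually_le_atBot 0]
      with τ hτ hneg
    have hexp : Real.exp (2 * γ * f τ) ≤ 1 :=
      Real.exp_le_one_iff.2 (mul_nonpos_of_nonneg_of_nonpos (by positivity) hneg)
    exact hτ.le.trans (mul_le_of_le_one_right (sq_nonneg _) hexp)
  obtain ⟨b, hb, hbnear⟩ := (mem_nhdsLT_iff_exists_Ioo_subset' ha).1 hnear
  have hsub : Set.Icc a (max a b) ⊆ Set.Ico a 0 := fun τ hτ =>
    ⟨hτ.1, hτ.2.trans_lt (max_lt ha hb)⟩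
  obtain ⟨x, hx, hmin⟩ := isCompact_Icc.exists_isMinOn
    (Set.nonempty_Icc.2 (le_max_left a b)) ((hcont.mono hsub).pow 2)
  refine ⟨min (m / 2) ((deriv f x) ^ 2),
    lt_min (half_pos hm) (sq_pos_of_ne_zero (hf' x (hsub hx))), fun τ hτ => ?_⟩
  rcases le_or_gt τ (max a b) with h | h
  · exact (min_le_right _ _).trans (hmin ⟨hτ.1, h⟩)
  · exact (min_le_left _ _).trans (hbnear ⟨(le_max_right a b).trans_lt h, hτ.2⟩)

/-- The third-order combination rewritten through `f'' + γ |f'|²` and its derivative, which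
eliminates the third derivative of `f`. -/
theorem third_deriv_combination_eq {f : ℝ → ℝ} {τ : ℝ} (γ : ℝ) (hf : ContDiffAt ℝ 3 f τ) :
    2 * (deriv (deriv f) τ) ^ 2 - deriv f τ * deriv (deriv (deriv f)) τ =
      2 * deriv (deriv f) τ * (deriv (deriv f) τ + γ * (deriv f τ) ^ 2) -
        deriv f τ * deriv (fun σ : ℝ => deriv (deriv f) σ + γ * (deriv f σ) ^ 2) τ := by
  have h1 : ContDiffAt ℝ 2 (deriv f) τ := hf.derivWithin (by norm_num)
  have h2 : ContDiffAt ℝ 1 (deriv (deriv f)) τ := h1.derivWithin (by norm_num)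
  have d1 := (h1.differentiableAt (by norm_num)).hasDerivAt
  have d2 := (h2.differentiableAt (by norm_num)).hasDerivAt
  rw [(d2.fun_add ((d1.fun_pow 2).const_mul γ)).deriv]
  push_cast
  ring

/-- If `f` is `C³` on `[a,0)` with `f → -∞`, `f' < 0`, `|f'|² e^{2γf} → m > 0`,
`f'' + γ |f'|²` bounded and `|(f'' + γ |f'|²)'| ≤ c₁ |f'|` on `[a,0)`, then
`|2 (f'')² - f' f'''| ≤ c |f'|²` on `[a,0)` for some constant `c > 0`. -/
theorem third_deriv_combination_bound (a : ℝ) (ha : a < 0)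
    (f : ℝ → ℝ) (γ m c₁ : ℝ) (hγ : 0 < γ) (hm : 0 < m)
    (hf : ContDiffOn ℝ 3 f (Set.Ico a 0))
    (hf' : ∀ τ ∈ Set.Ico a (0 : ℝ), deriv f τ < 0)
    (hfb : Tendsto f (𝓝[<] (0 : ℝ)) atBot)
    (hlim : Tendsto (fun τ : ℝ => (deriv f τ) ^ 2 * Real.exp (2 * γ * f τ))
      (𝓝[<] (0 : ℝ)) (𝓝 m))
    (hbd : ∃ C : ℝ, ∀ τ ∈ Set.Ico a (0 : ℝ),
      |deriv (deriv f) τ + γ * (deriv f τ) ^ 2| ≤ C)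
    (hbd' : ∀ τ ∈ Set.Ico a (0 : ℝ),
      |deriv (fun σ : ℝ => deriv (deriv f) σ + γ * (deriv f σ) ^ 2) τ| ≤
        c₁ * |deriv f τ|) :
    ∃ c : ℝ, 0 < c ∧ ∀ τ ∈ Set.Ico a (0 : ℝ),
      |2 * (deriv (deriv f) τ) ^ 2 - deriv f τ * deriv (deriv (deriv f)) τ| ≤
        c * (deriv f τ) ^ 2 := by
  obtain ⟨C, hC⟩ := hbd
  obtain ⟨k, hk, hkle⟩ := exists_pos_le_sq_deriv a ha f γ m hγ hm (hf.of_le (by norm_num))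
    (fun τ hτ => (hf' τ hτ).ne) hfb hlim
  have haI : a ∈ Set.Ico a (0 : ℝ) := ⟨le_rfl, ha⟩
  have hC0 : 0 ≤ C := (abs_nonneg _).trans (hC a haI)
  have hc₁ : 0 ≤ c₁ :=
    nonneg_of_mul_nonneg_left ((abs_nonneg _).trans (hbd' a haI)) (abs_pos.2 (hf' a haI).ne)
  -- The one-sided regularity at `a` says nothing about the two-sided higher derivatives there,
  -- so the endpoint contributes its own term to the constant.
  set A := |2 * (deriv (deriv f) a) ^ 2 - deriv f a * deriv (deriv (deriv f)) a|
  have hA0 : 0 ≤ A := abs_nonneg _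
  set B := 2 * (C / k + γ) * C + c₁ with hB
  have hB0 : 0 ≤ B := by positivity
  refine ⟨A / k + B + 1, by positivity, fun τ hτ => ?_⟩
  have hkτ := hkle τ hτ
  have hdiv : ∀ x : ℝ, 0 ≤ x → x ≤ x / k * (deriv f τ) ^ 2 := fun x hx => by
    rw [div_mul_eq_mul_div, le_div_iff₀ hk]
    exact mul_le_mul_of_nonneg_left hkτ hx
  rcases hτ.1.eq_or_lt with rfl | hlt
  · have h := hdiv A hA0
    nlinarith [mul_nonneg hB0 (sq_nonneg (deriv f a)), sq_nonneg (deriv f a)]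
  · rw [third_deriv_combination_eq γ (hf.contDiffAt (Ico_mem_nhds hlt hτ.2))]
    have hg := hC τ hτ
    set g := deriv (deriv f) τ + γ * (deriv f τ) ^ 2 with hgdef
    have hf2 : |deriv (deriv f) τ| ≤ (C / k + γ) * (deriv f τ) ^ 2 := by
      have h : deriv (deriv f) τ = g - γ * (deriv f τ) ^ 2 := by rw [hgdef]; ring
      have habs := norm_sub_le g (γ * (deriv f τ) ^ 2)
      simp only [Real.norm_eq_abs] at habs
      rw [← h, abs_of_nonneg (by positivity : 0 ≤ γ * (deriv f τ) ^ 2)] at habs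
      linarith [hdiv C hC0]
    have hprod : |2 * deriv (deriv f) τ * g| ≤ 2 * ((C / k + γ) * (deriv f τ) ^ 2) * C := by
      rw [abs_mul, abs_mul, abs_two]
      gcongr
    have hlast : |deriv f τ * deriv (fun σ : ℝ => deriv (deriv f) σ + γ * (deriv f σ) ^ 2) τ|
        ≤ c₁ * (deriv f τ) ^ 2 := by
      rw [abs_mul, ← sq_abs (deriv f τ)]
      nlinarith [mul_le_mul_of_nonneg_left (hbd' τ hτ) (abs_nonneg (deriv f τ))]
    have hrest : 0 ≤ (A / k + 1) * (deriv f τ) ^ 2 := by positivity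
    rw [← Real.norm_eq_abs]
    refine (norm_sub_le _ _).trans ?_
    rw [Real.norm_eq_abs, Real.norm_eq_abs, hB]
    linarith
end
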